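/- arXiv:2605.10151 — 7 statements merged into one kernel-verified Lean document; each statement's English description precedes it below -/
import Mathlib

section
/- Let θ*, θ̂ ∈ ℝ^d, let ε ≥ 0 with ‖θ̂ − θ*‖₂ ≤ ε, and let 1 ≤ H ≤ d be an integer. Let Ŝ ⊆ {1,…,d} with |Ŝ| = H satisfy min_{i ∈ Ŝ} |θ̂_i| − max_{j ∉ Ŝ} |θ̂_j| > 2ε, and let S* ⊆ {1,…,d} with |S*| = H satisfy min_{i ∈ S*} |θ*_i| ≥ max_{j ∉ S*} |θ*_j|. Then Ŝ = S* (here a maximum over an empty index set is interpreted as 0 and the conditions are vacuous only when H = d, in which case both sets equal {1,…,d}). -/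
/-- Support consistency: if `‖θ̂ − θ*‖₂ ≤ ε`, `Ŝ` has cardinality `H` with
empirical gap `min_{i∈Ŝ}|θ̂_i| − max_{j∉Ŝ}|θ̂_j| > 2ε` (stated pairwise, vacuous only when
`H = d`), and `S*` has cardinality `H` with `min_{i∈S*}|θ*_i| ≥ max_{j∉S*}|θ*_j|`,
then `Ŝ = S*`. -/
theorem stmt3 {d : ℕ} (θstar θhat : EuclideanSpace ℝ (Fin d)) (ε : ℝ) (hε : 0 ≤ ε)
    (herr : ‖θhat - θstar‖ ≤ ε) (H : ℕ) (hH1 : 1 ≤ H) (hHd : H ≤ d)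
    (Shat : Finset (Fin d)) (hShat : Shat.card = H)
    (hgap : ∀ i ∈ Shat, ∀ j ∉ Shat, |θhat j| + 2 * ε < |θhat i|)
    (Sstar : Finset (Fin d)) (hSstar : Sstar.card = H)
    (hord : ∀ i ∈ Sstar, ∀ j ∉ Sstar, |θstar j| ≤ |θstar i|) :
    Shat = Sstar := by
  by_contra hne
  obtain ⟨i, hi, hi'⟩ : ∃ i ∈ Shat, i ∉ Sstar := Finset.not_subset.mp fun h =>
    hne (Finset.eq_of_subset_of_card_le h (by omega))
  obtain ⟨j, hj, hj'⟩ : ∃ j ∈ Sstar, j ∉ Shat := Finset.not_subset.mp fun h =>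
    hne (Finset.eq_of_subset_of_card_le h (by omega)).symm
  have hcoord (k : Fin d) : |θhat k - θstar k| ≤ ε :=
    (PiLp.norm_apply_le (θhat - θstar) k).trans herr
  have hi_le := (abs_sub_abs_le_abs_sub (θhat i) (θstar i)).trans (hcoord i)
  have hj_le := (abs_sub_abs_le_abs_sub (θstar j) (θhat j)).trans
    ((abs_sub_comm _ _).trans_le (hcoord j))
  linarith [hgap i hi j hj', hord j hj i hi']
end

section
/- Let θ*, θ̂ ∈ ℝ^d, ε ≥ 0 with ‖θ̂ − θ*‖₂ ≤ ε, and let 1 ≤ H < d be an integer. If topmin_H(θ*) − topmin_{H+1}(θ*) > 4ε, then topmin_H(θ̂) − topmin_{H+1}(θ̂) > 2ε. -/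
/-- `topmin k w = max_{S ⊆ [d], |S| = k} min_{i ∈ S} |w_i|`, the `k`-th largest absolute
entry of `w`. -/
noncomputable def topmin {d : ℕ} (k : ℕ) (w : EuclideanSpace ℝ (Fin d)) : ℝ :=
  sSup {r : ℝ | ∃ S : Finset (Fin d), S.card = k ∧
    IsLeast ((fun i => |w i|) '' (S : Set (Fin d))) r}

theorem exists_isLeast_abs_image {d : ℕ} (w : EuclideanSpace ℝ (Fin d)) {S : Finset (Fin d)}
    (hS : S.Nonempty) : ∃ r, IsLeast ((fun i => |w i|) '' (S : Set (Fin d))) r := by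
  obtain ⟨i, hi, hmin⟩ := S.exists_min_image (fun i => |w i|) hS
  refine ⟨|w i|, ⟨i, hi, rfl⟩, ?_⟩
  rintro _ ⟨j, hj, rfl⟩
  exact hmin j hj

theorem le_topmin {d k : ℕ} {w : EuclideanSpace ℝ (Fin d)} {S : Finset (Fin d)} (hS : S.card = k)
    {r : ℝ} (hr : IsLeast ((fun i => |w i|) '' (S : Set (Fin d))) r) : r ≤ topmin k w := by
  refine le_csSup ⟨‖w‖, ?_⟩ ⟨S, hS, hr⟩
  rintro _ ⟨_, _, ⟨i, _, rfl⟩, _⟩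
  exact PiLp.norm_apply_le w i

/-- `topmin k` is `1`-Lipschitz with respect to the Euclidean norm. -/
theorem topmin_le_topmin_add_norm_sub {d k : ℕ} (hk : 1 ≤ k) (hkd : k ≤ d)
    (v w : EuclideanSpace ℝ (Fin d)) : topmin k v ≤ topmin k w + ‖v - w‖ := by
  have nonempty_of_card : ∀ S : Finset (Fin d), S.card = k → S.Nonempty := fun S hS =>
    Finset.card_pos.mp (by omega)
  obtain ⟨T, -, hT⟩ := Finset.exists_subset_card_eq
    (show k ≤ (Finset.univ : Finset (Fin d)).card by simpa using hkd)
  obtain ⟨t, ht⟩ := exists_isLeast_abs_image v (nonempty_of_card T hT)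
  refine csSup_le ⟨t, T, hT, ht⟩ ?_
  rintro r ⟨S, hS, hr⟩
  obtain ⟨q, hq⟩ := exists_isLeast_abs_image w (nonempty_of_card S hS)
  have hq_le := le_topmin hS hq
  obtain ⟨⟨i, hi, rfl⟩, -⟩ := hq
  have hr_le : r ≤ |v i| := hr.2 ⟨i, hi, rfl⟩
  have hnorm : |v i - w i| ≤ ‖v - w‖ := PiLp.norm_apply_le (v - w) i
  have htri := abs_sub_abs_le_abs_sub (v i) (w i)
  dsimp only at hq_le
  linarith

/-- If `‖θ̂ − θ*‖₂ ≤ ε`, `1 ≤ H < d` and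
`topmin_H(θ*) − topmin_{H+1}(θ*) > 4ε`, then `topmin_H(θ̂) − topmin_{H+1}(θ̂) > 2ε`. -/
theorem stmt5 {d : ℕ} (θstar θhat : EuclideanSpace ℝ (Fin d)) (ε : ℝ) (hε : 0 ≤ ε)
    (herr : ‖θhat - θstar‖ ≤ ε) (H : ℕ) (hH1 : 1 ≤ H) (hHd : H < d)
    (hgap : 4 * ε < topmin H θstar - topmin (H + 1) θstar) :
    2 * ε < topmin H θhat - topmin (H + 1) θhat := by
  have hH := topmin_le_topmin_add_norm_sub hH1 hHd.le θstar θhat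
  have hH' := topmin_le_topmin_add_norm_sub (Nat.le_add_left 1 H) hHd θhat θstar
  rw [norm_sub_rev] at hH
  linarith
end

section
/- Let X ⊆ ℝ^d be a nonempty compact set with 0 ∈ X and L_X = sup_{x ∈ X} ‖x‖₂. Let θ*, θ̂ ∈ ℝ^d and ε ≥ 0 with ‖θ̂ − θ*‖₂ ≤ ε, and let 1 ≤ H ≤ d be an integer. Suppose ĝ_1,…,ĝ_H are distinct indices in {1,…,d}; set Ĝ_0 = ∅ and Ĝ_k = {ĝ_1,…,ĝ_k}, and suppose that for every k ∈ {1,…,H} and every v ∈ {1,…,d}\Ĝ_{k−1} with v ≠ ĝ_k, one has h(Ĝ_{k−1} ∪ {ĝ_k}; θ̂) − h(Ĝ_{k−1} ∪ {v}; θ̂) > 2 L_X ε. Then for any indices g*_1,…,g*_H such that, setting G*_0 = ∅ and G*_k = G*_{k−1} ∪ {g*_k}, each g*_k ∈ {1,…,d}\G*_{k−1} satisfies h(G*_{k−1} ∪ {g*_k}; θ*) ≥ h(G*_{k−1} ∪ {v}; θ*) for all v ∈ {1,…,d}\G*_{k−1}, one has g*_k = ĝ_k for every k ∈ {1,…,H};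 in particular Ĝ_H = G*_H. -/
/-- The value function `h(S; θ) = sup { θᵀx : x ∈ X, supp(x) ⊆ S }`. -/
noncomputable def valueFn {d : ℕ} (X : Set (EuclideanSpace ℝ (Fin d)))
    (S : Finset (Fin d)) (θ : EuclideanSpace ℝ (Fin d)) : ℝ :=
  sSup ((fun x => ∑ i, θ i * x i) '' {x ∈ X | ∀ i, x i ≠ 0 → (i ∈ S)})

/-- The value function is Lipschitz in the parameter, with any constant bounding the norm on `X`. -/
theorem valueFn_le_add_mul_norm_sub {d : ℕ} {X : Set (EuclideanSpace ℝ (Fin d))}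
    (hX0 : (0 : EuclideanSpace ℝ (Fin d)) ∈ X) {L : ℝ} (hL : ∀ x ∈ X, ‖x‖ ≤ L)
    (S : Finset (Fin d)) (θ η : EuclideanSpace ℝ (Fin d)) :
    valueFn X S θ ≤ valueFn X S η + L * ‖θ - η‖ := by
  have hinner : ∀ u x : EuclideanSpace ℝ (Fin d), ∑ i, u i * x i = inner ℝ x u := by
    intro u x
    simp [PiLp.inner_apply]
  have hbound : ∀ u : EuclideanSpace ℝ (Fin d), ∀ x ∈ X, ∑ i, u i * x i ≤ L * ‖u‖ := by
    intro u x hx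
    rw [hinner]
    exact (real_inner_le_norm x u).trans
      (mul_le_mul_of_nonneg_right (hL x hx) (norm_nonneg u))
  unfold valueFn
  apply csSup_le
  · exact ⟨_, 0, ⟨hX0, by simp⟩, rfl⟩
  · rintro _ ⟨x, ⟨hx, hxS⟩, rfl⟩
    have hη : ∑ i, η i * x i ≤
        sSup ((fun x => ∑ i, η i * x i) '' {x ∈ X | ∀ i, x i ≠ 0 → i ∈ S}) := by
      refine le_csSup ⟨L * ‖η‖, ?_⟩ ⟨x, ⟨hx, hxS⟩, rfl⟩
      rintro _ ⟨y, ⟨hy, -⟩, rfl⟩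
      exact hbound η y hy
    have hsub := hbound (θ - η) x hx
    rw [hinner, inner_sub_right, ← hinner, ← hinner] at hsub
    simp only
    linarith

/-- Greedy support consistency: if the greedy run on `θ̂` has all its
step-wise gaps larger than `2 L_X ε` and `‖θ̂ − θ*‖₂ ≤ ε`, then any greedy run on `θ*`
selects exactly the same elements, in the same order; in particular `Ĝ_H = G*_H`. -/
theorem stmt6 {d : ℕ} (X : Set (EuclideanSpace ℝ (Fin d)))
    (hXne : X.Nonempty) (hXc : IsCompact X) (hX0 : (0 : EuclideanSpace ℝ (Fin d)) ∈ X)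
    (LX : ℝ) (hLX : IsLUB ((fun x : EuclideanSpace ℝ (Fin d) => ‖x‖) '' X) LX)
    (θstar θhat : EuclideanSpace ℝ (Fin d)) (ε : ℝ) (hε : 0 ≤ ε)
    (herr : ‖θhat - θstar‖ ≤ ε)
    (H : ℕ) (hH1 : 1 ≤ H) (hHd : H ≤ d)
    (ghat : ℕ → Fin d) (Ghat : ℕ → Finset (Fin d))
    (hGhat0 : Ghat 0 = ∅)
    (hGhatS : ∀ k < H, Ghat (k + 1) = insert (ghat k) (Ghat k))
    (hdistinct : ∀ k < H, ghat k ∉ Ghat k)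
    (hgapshat : ∀ k < H, ∀ v : Fin d, v ∉ Ghat k → v ≠ ghat k →
      2 * LX * ε < valueFn X (insert (ghat k) (Ghat k)) θhat
        - valueFn X (insert v (Ghat k)) θhat)
    (gstar : ℕ → Fin d) (Gstar : ℕ → Finset (Fin d))
    (hGstar0 : Gstar 0 = ∅)
    (hGstarS : ∀ k < H, Gstar (k + 1) = insert (gstar k) (Gstar k))
    (hstarnotin : ∀ k < H, gstar k ∉ Gstar k)
    (hstarmax : ∀ k < H, ∀ v : Fin d, v ∉ Gstar k →
      valueFn X (insert v (Gstar k)) θstar ≤ valueFn X (insert (gstar k) (Gstar k)) θstar) :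
    (∀ k < H, gstar k = ghat k) ∧ Gstar H = Ghat H := by
  have hL : ∀ x ∈ X, ‖x‖ ≤ LX := fun x hx => hLX.1 ⟨x, hx, rfl⟩
  have hL0 : 0 ≤ LX := (norm_nonneg _).trans (hL 0 hX0)
  have hmul : LX * ‖θhat - θstar‖ ≤ LX * ε := mul_le_mul_of_nonneg_left herr hL0
  have hstep : ∀ k < H, Gstar k = Ghat k → gstar k = ghat k := by
    intro k hk hG
    by_contra hne
    have hnotin := hstarnotin k hk
    have hmax := hstarmax k hk (ghat k) (hG ▸ hdistinct k hk)
    rw [hG] at hnotin hmax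
    have hgap := hgapshat k hk (gstar k) hnotin hne
    have hup := valueFn_le_add_mul_norm_sub hX0 hL (insert (ghat k) (Ghat k)) θhat θstar
    have hlow := valueFn_le_add_mul_norm_sub hX0 hL (insert (gstar k) (Ghat k)) θstar θhat
    rw [norm_sub_rev] at hlow
    linarith
  have hG : ∀ k ≤ H, Gstar k = Ghat k := by
    intro k
    induction k with
    | zero => intro _; rw [hGstar0, hGhat0]
    | succ k ih =>
      intro hk
      have hGk := ih (by omega)
      rw [hGstarS k hk, hGhatS k hk, hstep k hk hGk, hGk]
  exact ⟨fun k hk => hstep k hk (hG k hk.le), hG H le_rfl⟩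
end

section
/- Let X ⊆ ℝ^d be a nonempty compact set with 0 ∈ X and L_X = sup_{x ∈ X} ‖x‖₂. Then for any G ⊆ {1,…,d}, any v ∈ {1,…,d}, and any θ₁, θ₂ ∈ ℝ^d, the marginal gains satisfy |(h(G ∪ {v}; θ₁) − h(G; θ₁)) − (h(G ∪ {v}; θ₂) − h(G; θ₂))| ≤ 2 L_X ‖θ₁ − θ₂‖₂. -/
theorem sum_mul_le_norm_mul_norm {d : ℕ} (θ x : EuclideanSpace ℝ (Fin d)) :
    ∑ i, θ i * x i ≤ ‖θ‖ * ‖x‖ := by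
  have h := real_inner_le_norm θ x
  simpa [PiLp.inner_apply, mul_comm] using h

theorem valueFn_le_add {d : ℕ} {X : Set (EuclideanSpace ℝ (Fin d))}
    (hX0 : (0 : EuclideanSpace ℝ (Fin d)) ∈ X) {L : ℝ} (hL : ∀ x ∈ X, ‖x‖ ≤ L)
    (S : Finset (Fin d)) (θ₁ θ₂ : EuclideanSpace ℝ (Fin d)) :
    valueFn X S θ₁ ≤ valueFn X S θ₂ + L * ‖θ₁ - θ₂‖ := by
  have hbdd : BddAbove
      ((fun x => ∑ i, θ₂ i * x i) '' {x ∈ X | ∀ i, x i ≠ 0 → (i ∈ S)}) := by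
    refine ⟨‖θ₂‖ * L, ?_⟩
    rintro _ ⟨x, ⟨hx, -⟩, rfl⟩
    exact (sum_mul_le_norm_mul_norm θ₂ x).trans
      (mul_le_mul_of_nonneg_left (hL x hx) (norm_nonneg _))
  refine csSup_le ⟨_, 0, ⟨hX0, fun i hi => absurd rfl hi⟩, rfl⟩ ?_
  rintro _ ⟨x, hx, rfl⟩
  have hsup : ∑ i, θ₂ i * x i ≤ valueFn X S θ₂ := le_csSup hbdd ⟨x, hx, rfl⟩
  have hdiff : ∑ i, θ₁ i * x i - ∑ i, θ₂ i * x i ≤ ‖θ₁ - θ₂‖ * ‖x‖ := by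
    simpa [sub_mul, Finset.sum_sub_distrib] using sum_mul_le_norm_mul_norm (θ₁ - θ₂) x
  have hnorm := mul_le_mul_of_nonneg_left (hL x hx.1) (norm_nonneg (θ₁ - θ₂))
  change ∑ i, θ₁ i * x i ≤ _
  linarith

theorem abs_valueFn_sub_le {d : ℕ} {X : Set (EuclideanSpace ℝ (Fin d))}
    (hX0 : (0 : EuclideanSpace ℝ (Fin d)) ∈ X) {L : ℝ} (hL : ∀ x ∈ X, ‖x‖ ≤ L)
    (S : Finset (Fin d)) (θ₁ θ₂ : EuclideanSpace ℝ (Fin d)) :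
    |valueFn X S θ₁ - valueFn X S θ₂| ≤ L * ‖θ₁ - θ₂‖ := by
  have h₁ := valueFn_le_add hX0 hL S θ₁ θ₂
  have h₂ := valueFn_le_add hX0 hL S θ₂ θ₁
  rw [norm_sub_rev] at h₂
  exact abs_sub_le_iff.2 ⟨by linarith, by linarith⟩

/-- For a nonempty compact `X` with `0 ∈ X` and `L_X = sup_{x∈X}‖x‖₂`, the
marginal gains of the value function satisfy
`|(h(G∪{v};θ₁) − h(G;θ₁)) − (h(G∪{v};θ₂) − h(G;θ₂))| ≤ 2 L_X ‖θ₁ − θ₂‖₂`. -/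
theorem stmt7 {d : ℕ} (X : Set (EuclideanSpace ℝ (Fin d)))
    (hXne : X.Nonempty) (hXc : IsCompact X) (hX0 : (0 : EuclideanSpace ℝ (Fin d)) ∈ X)
    (LX : ℝ) (hLX : IsLUB ((fun x : EuclideanSpace ℝ (Fin d) => ‖x‖) '' X) LX)
    (G : Finset (Fin d)) (v : Fin d) (θ₁ θ₂ : EuclideanSpace ℝ (Fin d)) :
    |(valueFn X (insert v G) θ₁ - valueFn X G θ₁) -
      (valueFn X (insert v G) θ₂ - valueFn X G θ₂)| ≤ 2 * LX * ‖θ₁ - θ₂‖ := by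
  have hL : ∀ x ∈ X, ‖x‖ ≤ LX := fun x hx => hLX.1 ⟨x, hx, rfl⟩
  have hins := abs_le.1 (abs_valueFn_sub_le hX0 hL (insert v G) θ₁ θ₂)
  have hG := abs_le.1 (abs_valueFn_sub_le hX0 hL G θ₁ θ₂)
  exact abs_le.2 ⟨by linarith [hins.1, hG.2], by linarith [hins.2, hG.1]⟩
end

section
/- Let a, b ∈ ℝ^d with a ≠ 0 and b ≠ 0, and let L > 0. Then L ‖a‖₂ − L (aᵀb)/‖b‖₂ ≤ (2L/‖a‖₂) ‖a − b‖₂². Equivalently, with x*(θ) = L θ/‖θ‖₂ denoting the maximizer of θᵀx over the closed Euclidean ball of radius L, one has aᵀx*(a) − aᵀx*(b) ≤ (2L/‖a‖₂) ‖a − b‖₂². -/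
/-- The loss `‖a‖ - ⟪a, b⟫ / ‖b‖` incurred by using the direction
of `b` in place of that of `a` is quadratic in `‖a - b‖`. -/
theorem norm_sub_inner_div_norm_le {E : Type*} [NormedAddCommGroup E] [InnerProductSpace ℝ E]
    {a b : E} (ha : a ≠ 0) (hb : b ≠ 0) :
    ‖a‖ - inner ℝ a b / ‖b‖ ≤ 2 / ‖a‖ * ‖a - b‖ ^ 2 := by
  have hp : 0 < ‖a‖ := norm_pos_iff.mpr ha
  have hq : 0 < ‖b‖ := norm_pos_iff.mpr hb
  obtain ⟨hl, hu⟩ := abs_le.mp (abs_real_inner_le_norm a b)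
  rw [norm_sub_sq_real]
  generalize inner ℝ a b = s at *
  generalize ‖a‖ = p at *
  generalize ‖b‖ = q at *
  have key : 2 / p * (p ^ 2 - 2 * s + q ^ 2) - (p - s / q) =
      ((p * q + s) * (p - q) ^ 2 + (p * q - s) * (q ^ 2 + 2 * p * q)) / (p ^ 2 * q) := by
    field_simp
    ring
  have hnum : 0 ≤ (p * q + s) * (p - q) ^ 2 + (p * q - s) * (q ^ 2 + 2 * p * q) :=
    add_nonneg (mul_nonneg (by linarith) (sq_nonneg _)) (mul_nonneg (by linarith) (by positivity))
  rw [← sub_nonneg, key]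
  positivity

/-- For nonzero `a, b ∈ ℝ^d` and `L > 0`,
`L‖a‖ − L(aᵀb)/‖b‖ ≤ (2L/‖a‖)‖a − b‖²`; equivalently, with `x*(θ) = Lθ/‖θ‖` the maximizer
of `θᵀx` over the ball of radius `L`, `aᵀx*(a) − aᵀx*(b) ≤ (2L/‖a‖)‖a − b‖²`. -/
theorem stmt11 {d : ℕ} (a b : EuclideanSpace ℝ (Fin d)) (ha : a ≠ 0) (hb : b ≠ 0)
    (L : ℝ) (hL : 0 < L) :
    L * ‖a‖ - L * (∑ i, a i * b i) / ‖b‖ ≤ (2 * L / ‖a‖) * ‖a - b‖ ^ 2 ∧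
    (∑ i, a i * ((L / ‖a‖) • a) i) - (∑ i, a i * ((L / ‖b‖) • b) i) ≤
      (2 * L / ‖a‖) * ‖a - b‖ ^ 2 := by
  have hsum (v : EuclideanSpace ℝ (Fin d)) : ∑ i, a i * v i = inner ℝ a v := by
    simp [PiLp.inner_apply, mul_comm]
  have h := mul_le_mul_of_nonneg_left (norm_sub_inner_div_norm_le ha hb) hL.le
  have hp : ‖a‖ ≠ 0 := norm_ne_zero_iff.mpr ha
  have hmain : L * ‖a‖ - L * inner ℝ a b / ‖b‖ ≤ 2 * L / ‖a‖ * ‖a - b‖ ^ 2 := by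
    calc
      _ = L * (‖a‖ - inner ℝ a b / ‖b‖) := by ring
      _ ≤ L * (2 / ‖a‖ * ‖a - b‖ ^ 2) := h
      _ = _ := by ring
  simp only [hsum, inner_smul_right, real_inner_self_eq_norm_sq]
  refine ⟨hmain, ?_⟩
  convert hmain using 2
  · field_simp
  · ring
end

section
/- Let d ≥ 1 be an integer, δ ∈ (0,1), h₁ > 0 and Δ > 0, and set Γ = 16 h₁ / Δ². Assume 4Γ > e. Then every real number c with c ≥ 2Γ ln(2d/δ) + 8Γ ln(4Γ) satisfies h₁ ln(2dc²/δ)/c ≤ Δ²/16. -/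
/-- With `Γ = 16h₁/Δ²` and `4Γ > e`, every real
`c ≥ 2Γ ln(2d/δ) + 8Γ ln(4Γ)` satisfies `h₁ ln(2dc²/δ)/c ≤ Δ²/16`. -/
theorem stmt15 (d : ℕ) (hd : 1 ≤ d) (δ h₁ Δ : ℝ) (hδ0 : 0 < δ) (hδ1 : δ < 1)
    (hh₁ : 0 < h₁) (hΔ : 0 < Δ) (Γ : ℝ) (hΓ : Γ = 16 * h₁ / Δ ^ 2)
    (hΓe : Real.exp 1 < 4 * Γ) :
    ∀ c : ℝ, 2 * Γ * Real.log (2 * d / δ) + 8 * Γ * Real.log (4 * Γ) ≤ c →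
      h₁ * Real.log (2 * d * c ^ 2 / δ) / c ≤ Δ ^ 2 / 16 := by
  intro c hc
  have hd' : (1 : ℝ) ≤ d := by exact_mod_cast hd
  have hΓ0 : 0 < Γ := by rw [hΓ]; positivity
  have hlogΓ : 1 < Real.log (4 * Γ) := (Real.lt_log_iff_exp_lt (by positivity)).2 hΓe
  have hL : 0 < Real.log (2 * d / δ) := by
    apply Real.log_pos
    rw [lt_div_iff₀ hδ0]
    linarith
  have hΓL : 0 < Γ * Real.log (2 * d / δ) := mul_pos hΓ0 hL
  have hΓlog : 0 < Γ * Real.log (4 * Γ) := mul_pos hΓ0 (by linarith)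
  have hc0 : 0 < c := by linarith
  have hsplit : Real.log (2 * d * c ^ 2 / δ) = Real.log (2 * d / δ) + 2 * Real.log c := by
    rw [mul_div_right_comm, Real.log_mul (by positivity) (by positivity), Real.log_pow]
    norm_num
  have hlogc : Real.log c ≤ c / (4 * Γ) - 1 + Real.log (4 * Γ) := by
    have h := Real.log_le_sub_one_of_pos (x := c / (4 * Γ)) (by positivity)
    rw [Real.log_div hc0.ne' (by positivity)] at h
    linarith
  have hΓlogc : Γ * Real.log c ≤ c / 4 - Γ + Γ * Real.log (4 * Γ) := by
    calc Γ * Real.log c ≤ Γ * (c / (4 * Γ) - 1 + Real.log (4 * Γ)) := by gcongr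
      _ = c / 4 - Γ + Γ * Real.log (4 * Γ) := by field_simp
  have hmain : Γ * (Real.log (2 * d / δ) + 2 * Real.log c) ≤ c := by linarith
  have hh : h₁ = Δ ^ 2 / 16 * Γ := by rw [hΓ]; field_simp
  rw [hsplit, div_le_iff₀ hc0, hh, mul_assoc]
  gcongr
end

section
/- Let d ≥ 1 and 1 ≤ H ≤ d be integers, let γ ∈ (0,1], and let g be a real-valued function on subsets of {1,…,d} that is nonnegative, monotone nondecreasing (S ⊆ T implies g(S) ≤ g(T)), and satisfies g(∅) = 0. Let G_0 = ∅ and for k = 1,…,H let g_k ∈ {1,…,d}\G_{k−1} satisfy g(G_{k−1} ∪ {g_k}) ≥ g(G_{k−1} ∪ {v}) for every v ∈ {1,…,d}\G_{k−1}, and set G_k = G_{k−1} ∪ {g_k} (a greedy sequence). Assume that for every k ∈ {0,…,H−1} and every Ω ⊆ {1,…,d} with |Ω| ≤ H, Σ_{ω ∈ Ω\G_k} (g(G_k ∪ {ω}) − g(G_k)) ≥ γ (g(G_k ∪ Ω) − g(G_k)). Then g(G_H) ≥ (1 − e^{−γ}) · max { g(S) : S ⊆ {1,…,d}, |S| ≤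 H }. -/
/-- If the gap `s - a k` contracts by the factor `1 - γ / H` over each of the first `H` steps,
starting from a gap of at most `s`, then the final gap is at most `e^{-γ} s`. -/
theorem one_sub_exp_neg_mul_le_of_gap_le {H : ℕ} (hH : 1 ≤ H) {γ s : ℝ} (hγ : γ ≤ 1)
    (hs : 0 ≤ s) {a : ℕ → ℝ} (ha : 0 ≤ a 0)
    (hstep : ∀ k < H, γ * (s - a k) ≤ H * (a (k + 1) - a k)) :
    (1 - Real.exp (-γ)) * s ≤ a H := by
  have hH1 : (1 : ℝ) ≤ H := by exact_mod_cast hH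
  have hHpos : (0 : ℝ) < H := by linarith
  have hratio : 0 ≤ 1 - γ / H := by
    rw [sub_nonneg, div_le_one hHpos]
    exact hγ.trans hH1
  have hgap : ∀ k ≤ H, s - a k ≤ Real.exp (-(γ / H)) ^ k * s := by
    intro k
    induction k with
    | zero => intro _; simpa using ha
    | succ k ih =>
      intro hk
      have hdiv : γ / H * (s - a k) ≤ a (k + 1) - a k := by
        rw [div_mul_eq_mul_div, div_le_iff₀ hHpos, mul_comm (a (k + 1) - a k)]
        exact hstep k hk
      calc s - a (k + 1) ≤ (1 - γ / H) * (s - a k) := by linarith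
        _ ≤ (1 - γ / H) * (Real.exp (-(γ / H)) ^ k * s) :=
          mul_le_mul_of_nonneg_left (ih (by omega)) hratio
        _ ≤ Real.exp (-(γ / H)) * (Real.exp (-(γ / H)) ^ k * s) :=
          mul_le_mul_of_nonneg_right (Real.one_sub_le_exp_neg _) (by positivity)
        _ = Real.exp (-(γ / H)) ^ (k + 1) * s := by ring
  have hexp : Real.exp (-(γ / H)) ^ H = Real.exp (-γ) := by
    rw [← Real.exp_nat_mul]
    congr 1
    field_simp
  have hfinal := hgap H le_rfl
  rw [hexp] at hfinal
  linarith

/-- Greedy approximation guarantee with submodularity ratio: for a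
nonnegative monotone set function `g` with `g(∅) = 0`, a greedy sequence
`G_0 = ∅ ⊆ G_1 ⊆ … ⊆ G_H`, and submodularity-ratio condition with ratio `γ ∈ (0,1]`
along the greedy path, `g(G_H) ≥ (1 − e^{−γ}) g(S)` for every `S` with `|S| ≤ H`. -/
theorem stmt16 {d : ℕ} (hd : 1 ≤ d) (H : ℕ) (hH1 : 1 ≤ H) (hHd : H ≤ d)
    (γ : ℝ) (hγ0 : 0 < γ) (hγ1 : γ ≤ 1)
    (g : Finset (Fin d) → ℝ)
    (hg0 : ∀ S, 0 ≤ g S)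
    (hmono : ∀ S T : Finset (Fin d), S ⊆ T → g S ≤ g T)
    (hempty : g ∅ = 0)
    (gs : ℕ → Fin d) (G : ℕ → Finset (Fin d))
    (hG0 : G 0 = ∅)
    (hGk : ∀ k < H, G (k + 1) = insert (gs k) (G k))
    (hnotin : ∀ k < H, gs k ∉ G k)
    (hgreedy : ∀ k < H, ∀ v : Fin d, v ∉ G k →
      g (insert v (G k)) ≤ g (insert (gs k) (G k)))
    (hsub : ∀ k < H, ∀ Ω : Finset (Fin d), Ω.card ≤ H →
      γ * (g (G k ∪ Ω) - g (G k)) ≤ ∑ ω ∈ Ω \ G k, (g (insert ω (G k)) - g (G k))) :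
    ∀ S : Finset (Fin d), S.card ≤ H → (1 - Real.exp (-γ)) * g S ≤ g (G H) := by
  intro S hS
  refine one_sub_exp_neg_mul_le_of_gap_le (a := fun k => g (G k)) hH1 hγ1 (hg0 S) (hg0 _) ?_
  intro k hk
  have hgain : 0 ≤ g (G (k + 1)) - g (G k) :=
    sub_nonneg.mpr (hmono _ _ (hGk k hk ▸ Finset.subset_insert _ _))
  have hcard : (S \ G k).card ≤ H := (Finset.card_le_card Finset.sdiff_subset).trans hS
  calc γ * (g S - g (G k)) ≤ γ * (g (G k ∪ S) - g (G k)) := by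
        gcongr
        exact hmono _ _ Finset.subset_union_right
    _ ≤ ∑ ω ∈ S \ G k, (g (insert ω (G k)) - g (G k)) := hsub k hk S hS
    _ ≤ (S \ G k).card • (g (G (k + 1)) - g (G k)) := by
        refine Finset.sum_le_card_nsmul _ _ _ fun ω hω => ?_
        rw [hGk k hk]
        exact sub_le_sub_right (hgreedy k hk ω (Finset.mem_sdiff.mp hω).2) _
    _ ≤ H * (g (G (k + 1)) - g (G k)) := by
        rw [nsmul_eq_mul]
        gcongr
end
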